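/- arXiv:2206.10032 — 2 statements merged into one kernel-verified Lean document; each statement's English description precedes it below -/
import Mathlib

section
/- Under the hypotheses in the context, the average of the sequence g satisfies (1/T) Σ_{t=0}^{T−1} g_t ≤ 2(F_0 − f_*)/(s H √T) + 800 n K L² (R²+7)² γ² / H + 6 s K L (σ² + 2 K G²)/(H √T) + 808 n (n+1)² s K² L² (σ² + 2 K G²)/(H T) + 2 (R²+7)² γ² L √T /((n+1)² s H). -/
theorem sub_le_sum_of_step_le {T : ℕ} {F Φ g : ℕ → ℝ} {a c d : ℝ}
    (h : ∀ t < T, F (t + 1) - F t ≤ a * Φ t + c + d * g t) :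
    F T - F 0 ≤ a * ∑ t ∈ Finset.range T, Φ t + T * c + d * ∑ t ∈ Finset.range T, g t := by
  rw [← Finset.sum_range_sub]
  refine (Finset.sum_le_sum fun t ht => h t (Finset.mem_range.mp ht)).trans_eq ?_
  simp [Finset.sum_add_distrib, Finset.mul_sum]


theorem quafl_mean_gradient_convergence
    {n s K T : ℕ} (hn : 1 ≤ n) (hs : 1 ≤ s) (hK : 1 ≤ K) (hT : 1 ≤ T)
    (hsn : s ≤ n) (hKns : K ≤ n * s)
    {H L σ G B R γ fstar : ℝ}
    (hH : 1 ≤ H) (hL : 0 < L) (hσ : 0 ≤ σ) (hG : 0 ≤ G) (hB : 1 ≤ B ^ 2)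
    (hR : 0 < R) (hγ : 0 < γ)
    (η : ℝ) (hη : η = ((n : ℝ) + 1) / Real.sqrt T)
    (F Φ g : ℕ → ℝ)
    (hΦnonneg : ∀ t < T, 0 ≤ Φ t) (hgnonneg : ∀ t < T, 0 ≤ g t)
    (hFT : F T ≥ fstar)
    (hrec : ∀ t < T, F (t + 1) - F t ≤
      5 * η * (s : ℝ) * (K : ℝ) * L ^ 2 * Φ t / ((n : ℝ) * ((n : ℝ) + 1))
      + (4 * (s : ℝ) * L ^ 2 * η ^ 3 * (K : ℝ) ^ 3 / ((n : ℝ) + 1)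
          + 2 * (s : ℝ) ^ 2 * (K : ℝ) * η ^ 2 * L / ((n : ℝ) + 1) ^ 2)
        * (σ ^ 2 + 2 * (K : ℝ) * G ^ 2)
      + (R ^ 2 + 7) ^ 2 * γ ^ 2 * L / ((n : ℝ) + 1) ^ 2
      + (-(3 * η * (s : ℝ) * H) / (4 * ((n : ℝ) + 1))
          + 8 * B ^ 2 * L ^ 2 * η ^ 3 * (s : ℝ) * (K : ℝ) ^ 3 / ((n : ℝ) + 1)
          + 4 * B ^ 2 * (s : ℝ) ^ 2 * (K : ℝ) ^ 2 * L * η ^ 2 / ((n : ℝ) + 1) ^ 2) * g t)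
    (hΦsum : ∑ t ∈ Finset.range T, Φ t ≤
      80 * (T : ℝ) * (n : ℝ) ^ 2 * (R ^ 2 + 7) ^ 2 * γ ^ 2
      + 80 * (T : ℝ) * (n : ℝ) ^ 2 * (s : ℝ) * (K : ℝ) * η ^ 2 * (σ ^ 2 + 2 * (K : ℝ) * G ^ 2)
      + 160 * B ^ 2 * (n : ℝ) ^ 2 * (s : ℝ) * (K : ℝ) ^ 2 * η ^ 2
        * ∑ t ∈ Finset.range T, g t)
    (hsmall : 8 * B ^ 2 * L ^ 2 * η ^ 2 * (K : ℝ) ^ 3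
      + 4 * B ^ 2 * (s : ℝ) * (K : ℝ) ^ 2 * L * η / ((n : ℝ) + 1)
      + 800 * B ^ 2 * (n : ℝ) * (s : ℝ) * (K : ℝ) ^ 3 * η ^ 2 * L ^ 2 ≤ H / 4) :
    (1 / (T : ℝ)) * ∑ t ∈ Finset.range T, g t ≤
      2 * (F 0 - fstar) / ((s : ℝ) * H * Real.sqrt T)
      + 800 * (n : ℝ) * (K : ℝ) * L ^ 2 * (R ^ 2 + 7) ^ 2 * γ ^ 2 / H
      + 6 * (s : ℝ) * (K : ℝ) * L * (σ ^ 2 + 2 * (K : ℝ) * G ^ 2) / (H * Real.sqrt T)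
      + 808 * (n : ℝ) * ((n : ℝ) + 1) ^ 2 * (s : ℝ) * (K : ℝ) ^ 2 * L ^ 2
        * (σ ^ 2 + 2 * (K : ℝ) * G ^ 2) / (H * (T : ℝ))
      + 2 * (R ^ 2 + 7) ^ 2 * γ ^ 2 * L * Real.sqrt T / (((n : ℝ) + 1) ^ 2 * (s : ℝ) * H) := by
  have hn0 : (0 : ℝ) < n := by exact_mod_cast hn
  have hs0 : (0 : ℝ) < s := by exact_mod_cast hs
  have hK0 : (0 : ℝ) < K := by exact_mod_cast hK
  have hT0 : (0 : ℝ) < T := by exact_mod_cast hT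
  have hKns' : (K : ℝ) ≤ n * s := by exact_mod_cast hKns
  have hH0 : 0 < H := by linarith
  have hS : 0 ≤ ∑ t ∈ Finset.range T, g t :=
    Finset.sum_nonneg fun t ht => hgnonneg t (Finset.mem_range.mp ht)
  have hM : 0 ≤ σ ^ 2 + 2 * (K : ℝ) * G ^ 2 := by positivity
  have hq : 0 < Real.sqrt T := Real.sqrt_pos.mpr hT0
  have hqT : Real.sqrt T ^ 2 = T := Real.sq_sqrt hT0.le
  have hdescent := sub_le_sum_of_step_le (F := F) (Φ := Φ) (g := g)
    (a := 5 * η * s * K * L ^ 2 / (n * (n + 1))) fun t ht =>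
      (hrec t ht).trans_eq (by rw [mul_div_right_comm, add_assoc (_ * Φ t)])
  generalize ∑ t ∈ Finset.range T, g t = S at *
  generalize ∑ t ∈ Finset.range T, Φ t = P at *
  generalize Real.sqrt T = q at *
  generalize σ ^ 2 + 2 * (K : ℝ) * G ^ 2 = M at *
  generalize (T : ℝ) = τ at *
  generalize (K : ℝ) = k at *
  generalize (n : ℝ) = m at *
  generalize (s : ℝ) = r at *
  subst hqT
  have hη0 : 0 < η := by rw [hη]; positivity
  have hΦ := mul_le_mul_of_nonneg_left hΦsum
    (show 0 ≤ 5 * η * r * k * L ^ 2 / (m * (m + 1)) by positivity)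
  have hg := mul_le_mul_of_nonneg_left hsmall
    (show 0 ≤ η * r / (m + 1) * S by positivity)
  have hk3 : k ^ 3 ≤ m * r * k ^ 2 := by
    rw [pow_succ' k 2]
    gcongr
  have hk := mul_le_mul_of_nonneg_left hk3
    (show 0 ≤ 4 * r * L ^ 2 * η ^ 3 / (m + 1) * M * q ^ 2 by positivity)
  have hmain : η * r / (m + 1) * H / 2 * S ≤ F 0 - fstar
      + η * r / (m + 1) * (400 * q ^ 2 * m * k * L ^ 2 * ((R ^ 2 + 7) ^ 2 * γ ^ 2))
      + η * r / (m + 1) * (404 * q ^ 2 * m * r * k ^ 2 * L ^ 2 * η ^ 2 * M)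
      + 2 * r ^ 2 * k * η ^ 2 * L / (m + 1) ^ 2 * M * q ^ 2
      + q ^ 2 * ((R ^ 2 + 7) ^ 2 * γ ^ 2 * L / (m + 1) ^ 2) := by
    have hexpand : 5 * η * r * k * L ^ 2 / (m * (m + 1)) * (80 * q ^ 2 * m ^ 2 * (R ^ 2 + 7) ^ 2 * γ ^ 2
        + 80 * q ^ 2 * m ^ 2 * r * k * η ^ 2 * M + 160 * B ^ 2 * m ^ 2 * r * k ^ 2 * η ^ 2 * S)
        = η * r / (m + 1) * (400 * q ^ 2 * m * k * L ^ 2 * ((R ^ 2 + 7) ^ 2 * γ ^ 2)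
          + 400 * q ^ 2 * m * r * k ^ 2 * L ^ 2 * η ^ 2 * M
          + 800 * B ^ 2 * m * r * k ^ 3 * L ^ 2 * η ^ 2 * S) := by
      field_simp
      ring
    rw [hexpand] at hΦ
    generalize m + 1 = d at hdescent hΦ hg hk ⊢
    ring_nf at hdescent hΦ hg hk ⊢
    linarith
  have hcoef : η * r / (m + 1) = r / q := by rw [hη]; field_simp
  rw [hcoef] at hmain
  have hscaled := mul_le_mul_of_nonneg_left hmain (show 0 ≤ 2 / (r * H * q) by positivity)
  have hextra : 0 ≤ 2 * r * k * L * M / (H * q) := by positivity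
  calc 1 / q ^ 2 * S = 2 / (r * H * q) * (r / q * H / 2 * S) := by field_simp
    _ ≤ _ := hscaled
    _ = _ - 2 * r * k * L * M / (H * q) := by
      rw [hη]
      field_simp
      ring
    _ ≤ _ := sub_le_self _ hextra
end

section
/- Under the hypotheses in the context, the average of the sequence G satisfies (1/T) Σ_{t=0}^{T−1} G_t ≤ 15 F/(s H √T) + 24 s K L (σ² + 2 K G²)/(H √T) + (320 n² (n+1)² s K L²/T + 4824 n (n+1)² s K² L²/(H T))(σ² + 2 K G²) + (160 n² (n+1)² L/T + 2400 n (n+1)² K L/(H T)) F. -/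
theorem quafl_server_gradient_convergence
    {n s K T : ℕ} (hn : 1 ≤ n) (hs : 1 ≤ s) (hK : 1 ≤ K) (hT : 1 ≤ T) (hsn : s ≤ n)
    {H L σ G B R γ F : ℝ}
    (hH : 1 ≤ H) (hL : 0 < L) (hσ : 0 ≤ σ) (hG : 0 ≤ G) (hB : 1 ≤ B ^ 2)
    (hR : 0 < R) (hγ : 0 < γ) (hF : 0 ≤ F)
    (η : ℝ) (hη : η = ((n : ℝ) + 1) / Real.sqrt T)
    (hquant : (R ^ 2 + 7) ^ 2 * γ ^ 2 = η ^ 2 * (σ ^ 2 + 2 * (K : ℝ) * G ^ 2 + F / L))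
    (Gt Φ g : ℕ → ℝ)
    (hGtnonneg : ∀ t < T, 0 ≤ Gt t) (hΦnonneg : ∀ t < T, 0 ≤ Φ t)
    (hgnonneg : ∀ t < T, 0 ≤ g t)
    (hsmooth : ∀ t < T, Gt t ≤ 2 * L ^ 2 * Φ t + 2 * g t)
    (hΦsum : ∑ t ∈ Finset.range T, Φ t ≤
      80 * (T : ℝ) * (n : ℝ) ^ 2 * (R ^ 2 + 7) ^ 2 * γ ^ 2
      + 80 * (T : ℝ) * (n : ℝ) ^ 2 * (s : ℝ) * (K : ℝ) * η ^ 2 * (σ ^ 2 + 2 * (K : ℝ) * G ^ 2)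
      + 160 * B ^ 2 * (n : ℝ) ^ 2 * (s : ℝ) * (K : ℝ) ^ 2 * η ^ 2
        * ∑ t ∈ Finset.range T, g t)
    (hgavg : (1 / (T : ℝ)) * ∑ t ∈ Finset.range T, g t ≤
      5 * F / ((s : ℝ) * H * Real.sqrt T)
      + 8 * (s : ℝ) * (K : ℝ) * L * (σ ^ 2 + 2 * (K : ℝ) * G ^ 2) / (H * Real.sqrt T)
      + 1608 * (n : ℝ) * ((n : ℝ) + 1) ^ 2 * (s : ℝ) * (K : ℝ) ^ 2 * L ^ 2
        * (σ ^ 2 + 2 * (K : ℝ) * G ^ 2) / (H * (T : ℝ))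
      + 800 * (n : ℝ) * ((n : ℝ) + 1) ^ 2 * (K : ℝ) * L * F / (H * (T : ℝ)))
    (hsmall : 320 * B ^ 2 * (n : ℝ) ^ 2 * (s : ℝ) * (K : ℝ) ^ 2 * L ^ 2 * η ^ 2 ≤ 1) :
    (1 / (T : ℝ)) * ∑ t ∈ Finset.range T, Gt t ≤
      15 * F / ((s : ℝ) * H * Real.sqrt T)
      + 24 * (s : ℝ) * (K : ℝ) * L * (σ ^ 2 + 2 * (K : ℝ) * G ^ 2) / (H * Real.sqrt T)
      + (320 * (n : ℝ) ^ 2 * ((n : ℝ) + 1) ^ 2 * (s : ℝ) * (K : ℝ) * L ^ 2 / (T : ℝ)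
          + 4824 * (n : ℝ) * ((n : ℝ) + 1) ^ 2 * (s : ℝ) * (K : ℝ) ^ 2 * L ^ 2 / (H * (T : ℝ)))
        * (σ ^ 2 + 2 * (K : ℝ) * G ^ 2)
      + (160 * (n : ℝ) ^ 2 * ((n : ℝ) + 1) ^ 2 * L / (T : ℝ)
          + 2400 * (n : ℝ) * ((n : ℝ) + 1) ^ 2 * (K : ℝ) * L / (H * (T : ℝ))) * F := by
  have hTpos : (0 : ℝ) < T := by exact_mod_cast hT
  have hsK : (1 : ℝ) ≤ (s : ℝ) * K := by exact_mod_cast Nat.mul_pos hs hK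
  have hη2 : η ^ 2 = ((n : ℝ) + 1) ^ 2 / T := by
    rw [hη, div_pow, Real.sq_sqrt hTpos.le]
  have hV : 0 ≤ σ ^ 2 + 2 * (K : ℝ) * G ^ 2 := by positivity
  set V := σ ^ 2 + 2 * (K : ℝ) * G ^ 2
  set S := ∑ t ∈ Finset.range T, g t
  have hS : 0 ≤ S := Finset.sum_nonneg fun t ht => hgnonneg t (Finset.mem_range.mp ht)
  have hsum : ∑ t ∈ Finset.range T, Gt t ≤
      2 * L ^ 2 * ∑ t ∈ Finset.range T, Φ t + 2 * S := by
    rw [Finset.mul_sum, Finset.mul_sum, ← Finset.sum_add_distrib]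
    exact Finset.sum_le_sum fun t ht => hsmooth t (Finset.mem_range.mp ht)
  have hquant' : 80 * (T : ℝ) * (n : ℝ) ^ 2 * (R ^ 2 + 7) ^ 2 * γ ^ 2 =
      80 * (T : ℝ) * (n : ℝ) ^ 2 * (η ^ 2 * (V + F / L)) := by
    rw [← hquant]; ring
  rw [hquant'] at hΦsum
  have hΦL := mul_le_mul_of_nonneg_left hΦsum (by positivity : 0 ≤ 2 * L ^ 2)
  have habsorb := mul_le_mul_of_nonneg_right hsmall hS
  have hLF : L ^ 2 * (F / L) = L * F := by field_simp
  have hVsK : 160 * (T : ℝ) * (n : ℝ) ^ 2 * η ^ 2 * L ^ 2 * V * 1 ≤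
      160 * (T : ℝ) * (n : ℝ) ^ 2 * η ^ 2 * L ^ 2 * V * ((s : ℝ) * K) :=
    mul_le_mul_of_nonneg_left hsK (by positivity)
  have htotal : ∑ t ∈ Finset.range T, Gt t ≤
      T * (320 * (n : ℝ) ^ 2 * η ^ 2 * s * K * L ^ 2 * V
        + 160 * (n : ℝ) ^ 2 * η ^ 2 * L * F) + 3 * S := by
    linear_combination hsum + hΦL + habsorb + hVsK
      + 160 * (T : ℝ) * (n : ℝ) ^ 2 * η ^ 2 * hLF
  have havg : (1 / (T : ℝ)) * ∑ t ∈ Finset.range T, Gt t ≤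
      320 * (n : ℝ) ^ 2 * η ^ 2 * s * K * L ^ 2 * V
        + 160 * (n : ℝ) ^ 2 * η ^ 2 * L * F + 3 * ((1 / (T : ℝ)) * S) := by
    refine (mul_le_mul_of_nonneg_left htotal (by positivity)).trans_eq ?_
    field_simp
  rw [hη2] at havg
  linear_combination havg + 3 * hgavg
end
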